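/- Let a ∈ ℝ, ε > 0, x₀ ≥ 0, and let w : [0,∞)→ℝ be continuous with w(0) = 0. Let x̄ : [0,∞)→[0,∞) be continuous, ℓ̄ a boundary term for x̄, and μ, ν : [0,∞)→[0,∞) continuous nondecreasing with μ(0) = ν(0) = 0. Let ȳ : [0,∞)→ℝ be continuous, and suppose that for all t ≥ 0: x̄(t) = x₀ + w(t) + ℓ̄(t) + aμ(t) and ȳ(t) = x₀ + w(t) + λ̄(t) + aν(t), where λ̄(t) = ∫₀ᵗ 𝔭_ε(ȳ(s)) ds. Then for every t ≥ 0, (x̄(t) − ȳ(t))² ≤ 2 ∫₀ᵗ (ȳ(s))⁻ dℓ̄(s) + 2a ( ∫₀ᵗ (x̄(s) − ȳ(s)) dμ(s) − ∫₀ᵗ (x̄(s) − ȳ(s)) dν(s) ), where the integrals are with respect to the Lebesgue–Stieltjes measures induced by ℓ̄, μ and ν respectively. -/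

import Mathlib

open MeasureTheory Set

noncomputable def nnegPart (r : ℝ) : ℝ := max (-r) 0

open Classical in
noncomputable def lsMeasure (f : ℝ → ℝ) : Measure ℝ :=
  if h : Monotone f ∧ Continuous f then
    StieltjesFunction.measure
      { toFun := f, mono' := h.1, right_continuous' := fun _ => h.2.continuousWithinAt }
  else 0

def IsBoundaryTerm (x ℓ : ℝ → ℝ) : Prop :=
  Continuous ℓ ∧ Monotone ℓ ∧ (∀ s ≤ (0:ℝ), ℓ s = 0) ∧
    ∫⁻ s in Set.Ici (0:ℝ), ENNReal.ofReal (x s) ∂(lsMeasure ℓ) = 0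

noncomputable def supNorm (f : ℝ → ℝ) (t : ℝ) : ℝ :=
  sSup ((fun s => |f s|) '' Set.Icc 0 t)

noncomputable def modCont (f : ℝ → ℝ) (t δ : ℝ) : ℝ :=
  sSup ((fun p : ℝ × ℝ => |f p.1 - f p.2|) ''
    {p : ℝ × ℝ | p.1 ∈ Set.Icc 0 t ∧ p.2 ∈ Set.Icc 0 t ∧ |p.1 - p.2| ≤ δ})

noncomputable def penalty (ε : ℝ) (x : ℝ) : ℝ :=
  if x ≤ -ε then ε⁻¹ else if x < 0 then -(x / ε ^ 2) else 0

def HomogeneousSystem (n : ℕ) (a : ℝ) (x0 : Fin n → ℝ)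
    (w x ℓ : Fin n → ℝ → ℝ) : Prop :=
  (∀ i, 0 ≤ x0 i) ∧ (∀ i, Continuous (w i)) ∧ (∀ i, w i 0 = 0) ∧
  (∀ i, Continuous (x i)) ∧ (∀ i t, 0 ≤ t → 0 ≤ x i t) ∧
  (∀ i, IsBoundaryTerm (x i) (ℓ i)) ∧
  (∀ i t, 0 ≤ t → x i t = x0 i + w i t + ℓ i t +
      a * (((n : ℝ) - 1)⁻¹ * ∑ j ∈ Finset.univ.erase i, ℓ j t))

def CompletelyS {n : ℕ} (R : Matrix (Fin n) (Fin n) ℝ) : Prop :=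
  ∀ J : Finset (Fin n), J.Nonempty →
    ∃ x : Fin n → ℝ, (∀ j ∈ J, 0 ≤ x j) ∧ ∀ i ∈ J, 0 < ∑ j ∈ J, R i j * x j

lemma lsMeasure_eq_measure {f : ℝ → ℝ} (hm : Monotone f) (hc : Continuous f) :
    lsMeasure f = StieltjesFunction.measure
      { toFun := f, mono' := hm, right_continuous' := fun _ => hc.continuousWithinAt } :=
  dif_pos ⟨hm, hc⟩

lemma lsMeasure_Ioc {f : ℝ → ℝ} (hm : Monotone f) (hc : Continuous f) (a b : ℝ) :
    lsMeasure f (Ioc a b) = ENNReal.ofReal (f b - f a) := by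
  rw [lsMeasure_eq_measure hm hc, StieltjesFunction.measure_Ioc]

lemma lsMeasure_singleton {f : ℝ → ℝ} (hm : Monotone f) (hc : Continuous f) (a : ℝ) :
    lsMeasure f {a} = 0 := by
  rw [lsMeasure_eq_measure hm hc, StieltjesFunction.measure_singleton]
  have h : Function.leftLim f a = f a := hc.continuousAt.continuousWithinAt.leftLim_eq
  exact ENNReal.ofReal_eq_zero.2 (sub_nonpos.2 h.ge)

lemma lsMeasure_Ioo {f : ℝ → ℝ} (hm : Monotone f) (hc : Continuous f) (a b : ℝ) :
    lsMeasure f (Ioo a b) = ENNReal.ofReal (f b - f a) := by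
  have h : Function.leftLim f b = f b := hc.continuousAt.continuousWithinAt.leftLim_eq
  rw [lsMeasure_eq_measure hm hc, StieltjesFunction.measure_Ioo]
  exact congrArg (fun r => ENNReal.ofReal (r - f a)) h

lemma isLocallyFiniteMeasure_lsMeasure {f : ℝ → ℝ} (hm : Monotone f) (hc : Continuous f) :
    IsLocallyFiniteMeasure (lsMeasure f) := by
  rw [lsMeasure_eq_measure hm hc]
  infer_instance

lemma integral_Icc_lsMeasure_eq_Ioc {f : ℝ → ℝ} (hm : Monotone f) (hc : Continuous f)
    (g : ℝ → ℝ) (t : ℝ) :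
    ∫ s in Icc 0 t, g s ∂(lsMeasure f) = ∫ s in Ioc 0 t, g s ∂(lsMeasure f) :=
  integral_Icc_eq_integral_Ioc' (lsMeasure_singleton hm hc 0)

lemma integrableOn_Icc_lsMeasure {f g : ℝ → ℝ} (hm : Monotone f) (hc : Continuous f)
    (hg : Continuous g) (t : ℝ) : IntegrableOn g (Icc 0 t) (lsMeasure f) :=
  have := isLocallyFiniteMeasure_lsMeasure hm hc
  hg.continuousOn.integrableOn_compact isCompact_Icc

/-- Integration by parts for the Lebesgue-Stieltjes measures of continuous monotone functions. -/
lemma mul_eq_integral_lsMeasure_add {f g : ℝ → ℝ} (hfm : Monotone f) (hfc : Continuous f)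
    (hgm : Monotone g) (hgc : Continuous g) (hf0 : f 0 = 0) (hg0 : g 0 = 0) {t : ℝ}
    (ht : 0 ≤ t) :
    f t * g t = ∫ s in Icc 0 t, f s ∂(lsMeasure g) + ∫ s in Icc 0 t, g s ∂(lsMeasure f) := by
  have nonneg : ∀ {h : ℝ → ℝ}, Monotone h → h 0 = 0 → ∀ s ∈ Ioc 0 t, 0 ≤ h s :=
    fun hm h0 s hs => h0 ▸ hm hs.1.le
  have toLIntegral : ∀ {h k : ℝ → ℝ}, Monotone h → Continuous h → h 0 = 0 →
      Monotone k → Continuous k →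
      ENNReal.ofReal (∫ s in Icc 0 t, h s ∂(lsMeasure k))
        = ∫⁻ s in Ioc 0 t, ENNReal.ofReal (h s) ∂(lsMeasure k) := by
    intro h k hm hc h0 km kc
    rw [integral_Icc_lsMeasure_eq_Ioc km kc]
    exact ofReal_integral_eq_lintegral_ofReal
      ((integrableOn_Icc_lsMeasure km kc hc t).mono_set Ioc_subset_Icc_self)
      ((ae_restrict_iff' measurableSet_Ioc).2 (.of_forall (nonneg hm h0)))
  have integral_nonneg : ∀ {h k : ℝ → ℝ}, Monotone h → h 0 = 0 →
      0 ≤ ∫ s in Icc 0 t, h s ∂(lsMeasure k) := fun hm h0 =>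
    setIntegral_nonneg measurableSet_Icc fun s hs => h0 ▸ hm hs.1
  have := isLocallyFiniteMeasure_lsMeasure hfm hfc
  have := isLocallyFiniteMeasure_lsMeasure hgm hgc
  have : IsFiniteMeasure ((lsMeasure f).restrict (Ioc 0 t)) :=
    ⟨by rw [Measure.restrict_apply_univ, lsMeasure_Ioc hfm hfc]; exact ENNReal.ofReal_lt_top⟩
  have : IsFiniteMeasure ((lsMeasure g).restrict (Ioc 0 t)) :=
    ⟨by rw [Measure.restrict_apply_univ, lsMeasure_Ioc hgm hgc]; exact ENNReal.ofReal_lt_top⟩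
  set m := (lsMeasure f).restrict (Ioc 0 t) with hm
  set n := (lsMeasure g).restrict (Ioc 0 t) with hn
  have hS : MeasurableSet {p : ℝ × ℝ | p.1 ≤ p.2} := measurableSet_le measurable_fst measurable_snd
  have lower : m.prod n {p : ℝ × ℝ | p.1 ≤ p.2}
      = ∫⁻ s in Ioc 0 t, ENNReal.ofReal (f s) ∂(lsMeasure g) := by
    rw [Measure.prod_apply_symm hS]
    refine setLIntegral_congr_fun measurableSet_Ioc fun r hr => ?_
    have : (fun s : ℝ => (s, r)) ⁻¹' {p : ℝ × ℝ | p.1 ≤ p.2} = Iic r := rfl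
    rw [this, hm, Measure.restrict_apply measurableSet_Iic, inter_comm, Ioc_inter_Iic,
      min_eq_right hr.2, lsMeasure_Ioc hfm hfc, hf0, sub_zero]
  have upper : m.prod n {p : ℝ × ℝ | p.1 ≤ p.2}ᶜ
      = ∫⁻ s in Ioc 0 t, ENNReal.ofReal (g s) ∂(lsMeasure f) := by
    rw [Measure.prod_apply hS.compl]
    refine setLIntegral_congr_fun measurableSet_Ioc fun r hr => ?_
    have : (fun s : ℝ => (r, s)) ⁻¹' {p : ℝ × ℝ | p.1 ≤ p.2}ᶜ = Iio r := by
      ext s; simp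
    have hI : Iio r ∩ Ioc 0 t = Ioo 0 r := by
      ext s
      exact ⟨fun h => ⟨h.2.1, h.1⟩, fun h => ⟨h.2, h.1, h.2.le.trans hr.2⟩⟩
    rw [this, hn, Measure.restrict_apply measurableSet_Iio, hI, lsMeasure_Ioo hgm hgc, hg0, sub_zero]
  have total := measure_add_measure_compl (μ := m.prod n) hS
  rw [lower, upper, ← univ_prod_univ, Measure.prod_prod, hm, hn, Measure.restrict_apply_univ,
    Measure.restrict_apply_univ, lsMeasure_Ioc hfm hfc, lsMeasure_Ioc hgm hgc, hf0, hg0,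
    sub_zero, sub_zero, ← toLIntegral hfm hfc hf0 hgm hgc, ← toLIntegral hgm hgc hg0 hfm hfc,
    ← ENNReal.ofReal_add (integral_nonneg hfm hf0) (integral_nonneg hgm hg0),
    ← ENNReal.ofReal_mul (hf0 ▸ hfm ht)] at total
  exact ((ENNReal.ofReal_eq_ofReal_iff
    (add_nonneg (integral_nonneg hfm hf0) (integral_nonneg hgm hg0))
    (mul_nonneg (hf0 ▸ hfm ht) (hg0 ▸ hgm ht))).1 total).symm

lemma penalty_nonneg {ε : ℝ} (hε : 0 < ε) (x : ℝ) : 0 ≤ penalty ε x := by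
  unfold penalty
  split_ifs with h₁ h₂
  · positivity
  · rw [neg_nonneg]
    exact div_nonpos_of_nonpos_of_nonneg h₂.le (by positivity)
  · exact le_rfl

lemma penalty_of_nonneg {ε : ℝ} (hε : 0 < ε) {x : ℝ} (hx : 0 ≤ x) : penalty ε x = 0 := by
  unfold penalty
  rw [if_neg (by linarith), if_neg hx.not_gt]

lemma penalty_eq_min {ε : ℝ} (hε : 0 < ε) (x : ℝ) :
    penalty ε x = min ε⁻¹ (max (-(x / ε ^ 2)) 0) := by
  have hsq : 0 < ε ^ 2 := by positivity
  have hi : ε⁻¹ = ε / ε ^ 2 := by field_simp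
  unfold penalty
  split_ifs with h₁ h₂
  · rw [min_eq_left]
    refine le_max_of_le_left ?_
    rw [hi, ← neg_div]
    gcongr
    linarith
  · have h₃ : 0 ≤ -(x / ε ^ 2) := by
      rw [← neg_div]
      exact div_nonneg (by linarith) hsq.le
    rw [max_eq_left h₃, min_eq_right]
    rw [hi, ← neg_div]
    gcongr
    linarith
  · rw [max_eq_right, min_eq_right (by positivity)]
    rw [neg_nonpos]
    exact div_nonneg (not_lt.1 h₂) hsq.le

lemma continuous_penalty {ε : ℝ} (hε : 0 < ε) : Continuous (penalty ε) := by
  rw [funext (penalty_eq_min hε)]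
  fun_prop

/-- The Lebesgue-Stieltjes measure of a primitive of a continuous nonnegative function. -/
lemma lsMeasure_eq_withDensity {f p : ℝ → ℝ} (hp : Continuous p) (hp0 : ∀ s, 0 ≤ p s)
    (hf : ∀ t, f t = ∫ s in (0 : ℝ)..t, p s) (hfm : Monotone f) (hfc : Continuous f) :
    lsMeasure f = volume.withDensity fun s => ENNReal.ofReal (p s) := by
  have := isLocallyFiniteMeasure_lsMeasure hfm hfc
  refine Measure.ext_of_Ioc _ _ fun a b hab => ?_
  rw [lsMeasure_Ioc hfm hfc, withDensity_apply _ measurableSet_Ioc,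
    ← ofReal_integral_eq_lintegral_ofReal (hp.integrableOn_Ioc) (.of_forall hp0),
    ← intervalIntegral.integral_of_le hab.le, hf, hf,
    intervalIntegral.integral_interval_sub_left (hp.intervalIntegrable _ _)
      (hp.intervalIntegrable _ _)]

lemma monotone_primitive {f p : ℝ → ℝ} (hp : Continuous p) (hp0 : ∀ s, 0 ≤ p s)
    (hf : ∀ t, f t = ∫ s in (0 : ℝ)..t, p s) : Monotone f := by
  intro a b hab
  rw [← sub_nonneg, hf, hf, intervalIntegral.integral_interval_sub_left
    (hp.intervalIntegrable _ _) (hp.intervalIntegrable _ _)]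
  exact intervalIntegral.integral_nonneg hab fun s _ => hp0 s

lemma continuous_primitive_of_continuous {f p : ℝ → ℝ} (hp : Continuous p)
    (hf : ∀ t, f t = ∫ s in (0 : ℝ)..t, p s) : Continuous f := by
  rw [funext hf]
  exact intervalIntegral.continuous_primitive (fun a b => hp.intervalIntegrable a b) 0

/-- The chain rule for the square of a linear combination of continuous monotone functions. -/
lemma sq_eq_two_mul_sum_integral_lsMeasure {ι : Type*} [Fintype ι] {c : ι → ℝ} {f : ι → ℝ → ℝ}
    (hm : ∀ i, Monotone (f i)) (hc : ∀ i, Continuous (f i)) (h0 : ∀ i, f i 0 = 0)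
    {z : ℝ → ℝ} (hz : ∀ s, 0 ≤ s → z s = ∑ i, c i * f i s) {t : ℝ} (ht : 0 ≤ t) :
    z t ^ 2 = 2 * ∑ j, c j * ∫ s in Icc 0 t, z s ∂(lsMeasure (f j)) := by
  have hint : ∀ j, ∫ s in Icc 0 t, z s ∂(lsMeasure (f j))
      = ∑ i, c i * ∫ s in Icc 0 t, f i s ∂(lsMeasure (f j)) := by
    intro j
    rw [setIntegral_congr_fun measurableSet_Icc fun s hs => hz s hs.1, integral_finsetSum]
    · simp_rw [integral_const_mul]
    · exact fun i _ => (integrableOn_Icc_lsMeasure (hm j) (hc j) (hc i) t).const_mul (c i)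
  have hsq : z t ^ 2 = ∑ j, ∑ i, (c j * c i * ∫ s in Icc 0 t, f i s ∂(lsMeasure (f j))
      + c i * c j * ∫ s in Icc 0 t, f j s ∂(lsMeasure (f i))) := by
    rw [hz t ht, sq, Finset.sum_mul_sum]
    refine Finset.sum_congr rfl fun j _ => Finset.sum_congr rfl fun i _ => ?_
    have := mul_eq_integral_lsMeasure_add (hm i) (hc i) (hm j) (hc j) (h0 i) (h0 j) ht
    linear_combination c i * c j * this
  simp_rw [Finset.sum_add_distrib] at hsq
  rw [Finset.sum_comm (f := fun j i => c i * c j * ∫ s in Icc 0 t, f j s ∂(lsMeasure (f i))),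
    ← two_mul] at hsq
  simp_rw [hsq, hint, Finset.mul_sum, mul_assoc]

lemma integral_sub_lsMeasure_le {x y ℓ : ℝ → ℝ} (hx : Continuous x) (hy : Continuous y)
    (hb : IsBoundaryTerm x ℓ) (t : ℝ) :
    ∫ s in Icc 0 t, (x s - y s) ∂(lsMeasure ℓ) ≤ ∫ s in Icc 0 t, nnegPart (y s) ∂(lsMeasure ℓ) := by
  obtain ⟨hc, hm, -, h⟩ := hb
  rw [lintegral_eq_zero_iff (by fun_prop), Filter.EventuallyEq,
    ae_restrict_iff' measurableSet_Ici] at h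
  have hn : Continuous fun s => nnegPart (y s) := by
    unfold nnegPart
    fun_prop
  refine setIntegral_mono_ae_restrict (integrableOn_Icc_lsMeasure hm hc (hx.sub hy) t)
    (integrableOn_Icc_lsMeasure hm hc hn t) ?_
  rw [Filter.EventuallyLE, ae_restrict_iff' measurableSet_Icc]
  filter_upwards [h] with s hs hst
  have : x s ≤ 0 := ENNReal.ofReal_eq_zero.1 (hs hst.1)
  have := le_max_left (-y s) 0
  unfold nnegPart
  linarith

lemma integral_sub_lsMeasure_penalty_nonneg {ε : ℝ} (hε : 0 < ε) {x y l : ℝ → ℝ}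
    (hy : Continuous y) (hx0 : ∀ t, 0 ≤ t → 0 ≤ x t)
    (hl : ∀ t, l t = ∫ s in (0 : ℝ)..t, penalty ε (y s)) (t : ℝ) :
    0 ≤ ∫ s in Icc 0 t, (x s - y s) ∂(lsMeasure l) := by
  have hp : Continuous fun s => penalty ε (y s) := (continuous_penalty hε).comp hy
  have hp0 := fun s => penalty_nonneg hε (y s)
  rw [lsMeasure_eq_withDensity hp hp0 hl (monotone_primitive hp hp0 hl)
    (continuous_primitive_of_continuous hp hl)]
  refine integral_nonneg_of_ae ?_
  rw [Filter.EventuallyLE, ae_restrict_iff' measurableSet_Icc,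
    ae_withDensity_iff hp.measurable.ennreal_ofReal]
  refine .of_forall fun s hs hst => ?_
  have : y s < 0 := by
    by_contra! h
    exact hs (by rw [penalty_of_nonneg hε h, ENNReal.ofReal_zero])
  have := hx0 s hst.1
  simp only [Pi.zero_apply]
  linarith

theorem stmt15 (a ε x₀ : ℝ) (hε : 0 < ε) (hx₀ : 0 ≤ x₀)
    (w : ℝ → ℝ) (hw : Continuous w) (hw0 : w 0 = 0)
    (xbar : ℝ → ℝ) (hxbarc : Continuous xbar) (hxbarnn : ∀ t, 0 ≤ t → 0 ≤ xbar t)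
    (ℓbar : ℝ → ℝ) (hb : IsBoundaryTerm xbar ℓbar)
    (μ ν : ℝ → ℝ)
    (hμc : Continuous μ) (hμm : Monotone μ) (hμ0 : ∀ s ≤ (0:ℝ), μ s = 0)
    (hνc : Continuous ν) (hνm : Monotone ν) (hν0 : ∀ s ≤ (0:ℝ), ν s = 0)
    (ybar lambar : ℝ → ℝ) (hybarc : Continuous ybar)
    (hlambar : ∀ t, lambar t = ∫ s in (0:ℝ)..t, penalty ε (ybar s))
    (heqx : ∀ t, 0 ≤ t → xbar t = x₀ + w t + ℓbar t + a * μ t)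
    (heqy : ∀ t, 0 ≤ t → ybar t = x₀ + w t + lambar t + a * ν t) :
    ∀ t, 0 ≤ t →
      (xbar t - ybar t) ^ 2
        ≤ 2 * (∫ s in Set.Icc 0 t, nnegPart (ybar s) ∂(lsMeasure ℓbar))
          + 2 * a * ((∫ s in Set.Icc 0 t, (xbar s - ybar s) ∂(lsMeasure μ))
              - ∫ s in Set.Icc 0 t, (xbar s - ybar s) ∂(lsMeasure ν)) := by
  intro t ht
  have hp : Continuous fun s => penalty ε (ybar s) := (continuous_penalty hε).comp hybarc
  have hp0 := fun s => penalty_nonneg hε (ybar s)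
  have hsq := sq_eq_two_mul_sum_integral_lsMeasure (c := ![1, -1, a, -a])
    (f := ![ℓbar, lambar, μ, ν]) (z := fun s => xbar s - ybar s)
    (by simp [Fin.forall_fin_succ, hb.2.1, monotone_primitive hp hp0 hlambar, hμm, hνm])
    (by simp [Fin.forall_fin_succ, hb.1, continuous_primitive_of_continuous hp hlambar, hμc, hνc])
    (by simp [Fin.forall_fin_succ, hb.2.2.1, hlambar, hμ0, hν0])
    (fun s hs => by
      simp only [Fin.sum_univ_four, Matrix.cons_val]
      rw [heqx s hs, heqy s hs]
      ring)
    ht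
  simp only [Fin.sum_univ_four, Matrix.cons_val] at hsq
  have hℓ := integral_sub_lsMeasure_le hxbarc hybarc hb t
  have hlam := integral_sub_lsMeasure_penalty_nonneg hε hybarc hxbarnn hlambar t
  linarith
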